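/- There exist Σ^0_3 sets universal for the Fubini products N ⊗ M and M ⊗ N on the square of a Polish space X: e.g., for N ⊗ M, there is a Σ^0_3 set U ⊆ ω^ω × X² whose sections all lie in N ⊗ M and such that every member of N ⊗ M is contained in some section. -/

import Mathlib

open MeasureTheory

/-- The additive Borel classes `Σ^0_α`: `SigmaClass α s` holds if `s` is open,
or `s` is a countable union of sets whose complements lie in classes
`Σ^0_β` with `1 ≤ β < α`.  In particular `SigmaClass 3` is the class `Σ^0_3`. -/
inductive SigmaClass {X : Type*} [TopologicalSpace X] : Ordinal.{0} → Set X → Prop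
  | of_isOpen {α : Ordinal.{0}} (s : Set X) : IsOpen s → SigmaClass α s
  | iUnion {α : Ordinal.{0}} (f : ℕ → Set X) (β : ℕ → Ordinal.{0}) :
      (∀ n, 1 ≤ β n) → (∀ n, β n < α) → (∀ n, SigmaClass (β n) (f n)ᶜ) →
      SigmaClass α (⋃ n, f n)

/-- The Fubini product `I ⊗ J` of ideals: `A ∈ I ⊗ J` iff `A` is covered by a
Borel set `B ⊆ Y × Z` such that `{y | B_y ∉ J} ∈ I`. -/
def FubiniProd {Y Z : Type*} [MeasurableSpace Y] [MeasurableSpace Z]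
    (I : Set (Set Y)) (J : Set (Set Z)) : Set (Set (Y × Z)) :=
  {A | ∃ B : Set (Y × Z), MeasurableSet B ∧ A ⊆ B ∧
    {y : Y | {z : Z | (y, z) ∈ B} ∉ J} ∈ I}


section Coding

/-- code splitting: the part of the code used for the `G_δ` part -/
def pg (c : ℕ → ℕ) (j i : ℕ) : ℕ := c (Nat.pair 0 (Nat.pair j i))
/-- code splitting: the part of the code used for the `F_σ` part -/
def pf (c : ℕ → ℕ) (k m : ℕ) : ℕ := c (Nat.pair 1 (Nat.pair k m))

lemma exists_code (g f : ℕ → ℕ → ℕ) : ∃ c : ℕ → ℕ, pg c = g ∧ pf c = f := by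
  refine ⟨fun n => if n.unpair.1 = 0 then g n.unpair.2.unpair.1 n.unpair.2.unpair.2
    else f n.unpair.2.unpair.1 n.unpair.2.unpair.2, ?_, ?_⟩
  · funext j i; simp [pg]
  · funext j i; simp [pf]

variable {Z Y : Type}

/-- finite partial unions -/
def Rr (O : ℕ → Set Z) (s : ℕ → ℕ) (i : ℕ) : Set Z := {z | ∃ a, a ≤ i ∧ z ∈ O (s a)}

/-- finite partial unions, cut off when the predicate `P` fails -/
def Ss (P : Set Z → Prop) (O : ℕ → Set Z) (s : ℕ → ℕ) (i : ℕ) : Set Z :=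
  {z | P (Rr O s i) ∧ z ∈ Rr O s i}

/-- The universal set -/
def UU (φ : Y → Z) (P : ℕ → Set Z → Prop) (O : ℕ → Set Z) (T : ℕ → ℕ → Set Y) :
    Set ((ℕ → ℕ) × Y) :=
  {q | (∀ j, ∃ i, φ q.2 ∈ Ss (P j) O (pg q.1 j) i) ∨ ∃ k, ∀ m, q.2 ∉ T m (pf q.1 k m)}

lemma Ss_directed (P : Set Z → Prop) (O : ℕ → Set Z) (s : ℕ → ℕ) :
    Directed (· ⊆ ·) (Ss P O s) := by
  intro i i'
  by_cases h : P (Rr O s i)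
  · by_cases h' : P (Rr O s i')
    · rcases le_total i i' with hi | hi
      · refine ⟨i', ?_, subset_rfl⟩
        rintro z ⟨_, a, ha, hz⟩
        exact ⟨h', a, ha.trans hi, hz⟩
      · refine ⟨i, subset_rfl, ?_⟩
        rintro z ⟨_, a, ha, hz⟩
        exact ⟨h, a, ha.trans hi, hz⟩
    · exact ⟨i, subset_rfl, fun z hz => absurd hz.1 h'⟩
  · exact ⟨i', fun z hz => absurd hz.1 h, subset_rfl⟩

variable [TopologicalSpace Z] [TopologicalSpace Y]

lemma isOpen_Rr (O : ℕ → Set Z) (hO : ∀ n, IsOpen (O n)) (s : ℕ → ℕ) (i : ℕ) :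
    IsOpen (Rr O s i) := by
  have : Rr O s i = ⋃ a, ⋃ (_ : a ≤ i), O (s a) := by ext z; simp [Rr]
  rw [this]
  exact isOpen_iUnion fun a => isOpen_iUnion fun _ => hO _

lemma isOpen_Ss (P : Set Z → Prop) (O : ℕ → Set Z) (hO : ∀ n, IsOpen (O n)) (s : ℕ → ℕ) (i : ℕ) :
    IsOpen (Ss P O s i) := by
  by_cases h : P (Rr O s i)
  · have : Ss P O s i = Rr O s i := by ext z; simp [Ss, h]
    rw [this]; exact isOpen_Rr O hO s i
  · have : Ss P O s i = ∅ := by ext z; simp [Ss, h]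
    rw [this]; exact isOpen_empty

lemma isOpen_Ss_prod (φ : Y → Z) (hφ : Continuous φ) (P : Set Z → Prop) (O : ℕ → Set Z)
    (hO : ∀ n, IsOpen (O n)) (j i : ℕ) :
    IsOpen {q : (ℕ → ℕ) × Y | φ q.2 ∈ Ss P O (pg q.1 j) i} := by
  have : {q : (ℕ → ℕ) × Y | φ q.2 ∈ Ss P O (pg q.1 j) i} =
      ⋃ c0 : ℕ → ℕ, (⋂ a ∈ Set.Iic i, {c : ℕ → ℕ | pg c j a = pg c0 j a}) ×ˢ
        (φ ⁻¹' (Ss P O (pg c0 j) i)) := by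
    ext ⟨c, y⟩
    simp only [Set.mem_ofPred_eq, Set.mem_iUnion, Set.mem_prod, Set.mem_iInter, Set.mem_Iic,
      Set.mem_preimage]
    constructor
    · intro h; exact ⟨c, fun _ _ => rfl, h⟩
    · rintro ⟨c0, h, h2⟩
      have : Rr O (pg c j) i = Rr O (pg c0 j) i := by
        ext z
        constructor
        · rintro ⟨a, ha, hz⟩; exact ⟨a, ha, by rwa [← h a ha]⟩
        · rintro ⟨a, ha, hz⟩; exact ⟨a, ha, by rwa [h a ha]⟩
      simpa [Ss, this] using h2
  rw [this]
  refine isOpen_iUnion fun c0 => IsOpen.prod ?_ ((isOpen_Ss P O hO _ _).preimage hφ)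
  refine (Set.finite_Iic i).isOpen_biInter fun a _ => ?_
  have hc : Continuous fun c : ℕ → ℕ => pg c j a := continuous_apply (Nat.pair 0 (Nat.pair j a))
  exact (isOpen_discrete {pg c0 j a}).preimage hc

lemma isOpen_T_prod (T : ℕ → Set Y) (hT : ∀ n, IsOpen (T n)) (k m : ℕ) :
    IsOpen {q : (ℕ → ℕ) × Y | q.2 ∈ T (pf q.1 k m)} := by
  have : {q : (ℕ → ℕ) × Y | q.2 ∈ T (pf q.1 k m)} =
      ⋃ n : ℕ, {c : ℕ → ℕ | pf c k m = n} ×ˢ T n := by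
    ext ⟨c, y⟩
    simp
  rw [this]
  refine isOpen_iUnion fun n => IsOpen.prod ?_ (hT n)
  have hc : Continuous fun c : ℕ → ℕ => pf c k m := continuous_apply (Nat.pair 1 (Nat.pair k m))
  exact (isOpen_discrete {n}).preimage hc

lemma sigmaClass_UU (φ : Y → Z) (hφ : Continuous φ) (P : ℕ → Set Z → Prop) (O : ℕ → Set Z)
    (hO : ∀ n, IsOpen (O n)) (T : ℕ → ℕ → Set Y) (hT : ∀ m n, IsOpen (T m n)) :
    SigmaClass 3 (UU φ P O T) := by
  let A : ℕ → Set ((ℕ → ℕ) × Y) := fun j => {q | ∃ i, φ q.2 ∈ Ss (P j) O (pg q.1 j) i}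
  have hA : ∀ j, IsOpen (A j) := by
    intro j
    have : A j = ⋃ i, {q : (ℕ → ℕ) × Y | φ q.2 ∈ Ss (P j) O (pg q.1 j) i} := by
      ext q; simp [A]
    rw [this]
    exact isOpen_iUnion fun i => isOpen_Ss_prod φ hφ _ O hO j i
  let C : ℕ → Set ((ℕ → ℕ) × Y) := fun k => ⋃ m, {q | q.2 ∈ T m (pf q.1 k m)}
  have hC : ∀ k, IsOpen (C k) := fun k => isOpen_iUnion fun m => isOpen_T_prod (T m) (hT m) k m
  let f : ℕ → Set ((ℕ → ℕ) × Y) := fun n => Nat.casesOn n (⋂ j, A j) (fun k => (C k)ᶜ)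
  have hf : UU φ P O T = ⋃ n, f n := by
    ext q
    simp only [UU, Set.mem_ofPred_eq, Set.mem_iUnion]
    constructor
    · rintro (h | ⟨k, h⟩)
      · exact ⟨0, by simpa [f, A] using h⟩
      · exact ⟨k + 1, by simpa [f, C] using h⟩
    · rintro ⟨n, h⟩
      cases n with
      | zero => left; simpa [f, A] using h
      | succ k => right; exact ⟨k, by simpa [f, C] using h⟩
  have h12 : (1 : Ordinal.{0}) < 2 := by norm_num
  have h23 : (2 : Ordinal.{0}) < 3 := by norm_num
  rw [hf]
  refine SigmaClass.iUnion f (fun _ => 2) (fun _ => h12.le) (fun _ => h23) ?_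
  intro n
  cases n with
  | zero =>
    have : (f 0)ᶜ = ⋃ j, (A j)ᶜ := by simp [f, Set.compl_iInter]
    rw [this]
    refine SigmaClass.iUnion _ (fun _ => 1) (fun _ => le_rfl) (fun _ => h12) ?_
    intro j
    rw [compl_compl]
    exact SigmaClass.of_isOpen _ (hA j)
  | succ k =>
    have : (f (k + 1))ᶜ = C k := by simp [f]
    rw [this]
    exact SigmaClass.of_isOpen _ (hC k)

lemma measurable_UU [MeasurableSpace Y] [OpensMeasurableSpace Y]
    (φ : Y → Z) (hφ : Continuous φ) (P : ℕ → Set Z → Prop) (O : ℕ → Set Z)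
    (hO : ∀ n, IsOpen (O n)) (T : ℕ → ℕ → Set Y) (hT : ∀ m n, IsOpen (T m n)) (c : ℕ → ℕ) :
    MeasurableSet {y | (c, y) ∈ UU φ P O T} := by
  have : {y | (c, y) ∈ UU φ P O T} = (⋂ j, ⋃ i, φ ⁻¹' (Ss (P j) O (pg c j) i)) ∪
      ⋃ k, ⋂ m, (T m (pf c k m))ᶜ := by
    ext y; simp [UU]
  rw [this]
  refine MeasurableSet.union ?_ ?_
  · exact MeasurableSet.iInter fun j => MeasurableSet.iUnion fun i =>
      ((isOpen_Ss _ O hO _ _).preimage hφ).measurableSet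
  · exact MeasurableSet.iUnion fun j => MeasurableSet.iInter fun i =>
      (hT _ _).measurableSet.compl

/-- an enumerated base containing the empty set -/
lemma exists_base (Z : Type) [TopologicalSpace Z] [SecondCountableTopology Z] :
    ∃ O : ℕ → Set Z, TopologicalSpace.IsTopologicalBasis (Set.range O) ∧ ∃ e, O e = ∅ := by
  obtain ⟨b, hbc, _, hb⟩ := TopologicalSpace.exists_countable_basis Z
  obtain ⟨O, hO⟩ := (hbc.insert ∅).exists_eq_range ⟨∅, Set.mem_insert _ _⟩
  refine ⟨O, hO ▸ hb.insert_empty, ?_⟩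
  have : ∅ ∈ Set.range O := hO ▸ Set.mem_insert _ _
  exact this

/-- any open set with the property (hereditary) has a code. -/
lemma exists_seq_open (O : ℕ → Set Z) (hO : TopologicalSpace.IsTopologicalBasis (Set.range O))
    (he : ∃ e, O e = ∅) (P : Set Z → Prop) (hP : ∀ A B, A ⊆ B → P B → P A)
    (V : Set Z) (hV : IsOpen V) (hPV : P V) :
    ∃ s : ℕ → ℕ, ∀ z ∈ V, ∃ i, z ∈ Ss P O s i := by
  classical
  obtain ⟨e, he⟩ := he
  refine ⟨fun i => if O i ⊆ V then i else e, fun z hz => ?_⟩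
  obtain ⟨_, ⟨n, rfl⟩, hzn, hn⟩ := hO.exists_subset_of_mem_open hz hV
  refine ⟨n, hP _ V ?_ hPV, n, le_rfl, by simpa [hn] using hzn⟩
  rintro w ⟨a, _, hw⟩
  dsimp only at hw
  split_ifs at hw with h
  · exact h hw
  · simp [he] at hw

end Coding

section CatNull

open Filter Topology

set_option linter.unusedSectionVars false
open scoped ENNReal

variable {X : Type} [TopologicalSpace X] [PolishSpace X] [MeasurableSpace X] [BorelSpace X]

/-- outer approximation by open sets, sectionwise in measure, for comeagre many sections -/
def OutApprox (ν : Measure X) (B : Set (X × X)) : Prop :=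
  ∀ ε : ℝ≥0∞, ε ≠ 0 → ∃ H : Set (X × X), IsOpen H ∧ ∀ᶠ x in residual X,
    Prod.mk x ⁻¹' B ⊆ Prod.mk x ⁻¹' H ∧ ν (Prod.mk x ⁻¹' H \ Prod.mk x ⁻¹' B) ≤ ε

lemma OutApprox.of_isOpen (ν : Measure X) {B : Set (X × X)} (hB : IsOpen B) :
    OutApprox ν B := by
  intro ε _
  exact ⟨B, hB, Eventually.of_forall fun x => ⟨subset_rfl, by simp⟩⟩

lemma OutApprox.iUnion (ν : Measure X) {B : ℕ → Set (X × X)} (hB : ∀ n, OutApprox ν (B n)) :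
    OutApprox ν (⋃ n, B n) := by
  intro ε hε
  obtain ⟨δ, δpos, hδ⟩ := ENNReal.exists_pos_sum_of_countable' hε ℕ
  choose H hHo hH using fun n => hB n (δ n) (δpos n).ne'
  refine ⟨⋃ n, H n, isOpen_iUnion hHo, ?_⟩
  filter_upwards [eventually_countable_forall.2 hH] with x hx
  refine ⟨?_, ?_⟩
  · simp only [Set.preimage_iUnion]
    exact Set.iUnion_mono fun n => (hx n).1
  · calc ν (Prod.mk x ⁻¹' (⋃ n, H n) \ Prod.mk x ⁻¹' (⋃ n, B n))
        ≤ ν (⋃ n, (Prod.mk x ⁻¹' (H n) \ Prod.mk x ⁻¹' (B n))) := by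
          apply measure_mono
          rintro z ⟨hz, hz'⟩
          simp only [Set.mem_preimage, Set.mem_iUnion, not_exists] at hz hz'
          obtain ⟨n, hn⟩ := hz
          exact Set.mem_iUnion.2 ⟨n, hn, hz' n⟩
      _ ≤ ∑' n, ν (Prod.mk x ⁻¹' (H n) \ Prod.mk x ⁻¹' (B n)) := measure_iUnion_le _
      _ ≤ ∑' n, δ n := ENNReal.tsum_le_tsum fun n => (hx n).2
      _ ≤ ε := hδ.le

lemma OutApprox.iInter (ν : Measure X) [IsFiniteMeasure ν] {B : ℕ → Set (X × X)}
    (hm : ∀ n, MeasurableSet (B n))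
    (hB : ∀ n, OutApprox ν (B n)) :
    OutApprox ν (⋂ n, B n) := by
  intro ε hε
  have hε2 : ε / 2 ≠ 0 := (ENNReal.half_pos hε).ne'
  obtain ⟨δ, δpos, hδ⟩ := ENNReal.exists_pos_sum_of_countable' hε2 ℕ
  choose H hHo hH using fun n => hB n (δ n) (δpos n).ne'
  let D : ℕ → Set (X × X) := fun n => ⋂ i ∈ Set.Iic n, B i
  have hDm : ∀ n, MeasurableSet (D n) := fun n =>
    MeasurableSet.biInter (Set.to_countable _) fun i _ => hm i
  let E : ℕ → Set X := fun n => {x | ν (Prod.mk x ⁻¹' (D n \ ⋂ n, B n)) ≤ ε / 2}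
  have hEm : ∀ n, MeasurableSet (E n) := fun n =>
    measurableSet_le (measurable_measure_prodMk_left ((hDm n).diff (MeasurableSet.iInter hm)))
      measurable_const
  have hEx : ∀ x, ∃ n, x ∈ E n := by
    intro x
    have h1 : Tendsto (ν ∘ fun n => Prod.mk x ⁻¹' (D n \ ⋂ n, B n)) atTop
        (𝓝 (ν (⋂ n, Prod.mk x ⁻¹' (D n \ ⋂ n, B n)))) := by
      apply tendsto_measure_iInter_atTop
      · intro n
        exact (measurable_prodMk_left ((hDm n).diff (MeasurableSet.iInter hm))).nullMeasurableSet
      · intro a b hab z hz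
        refine ⟨?_, hz.2⟩
        have := hz.1
        simp only [D, Set.mem_iInter, Set.mem_Iic] at this ⊢
        exact fun i hi => this i (hi.trans hab)
      · exact ⟨0, measure_ne_top _ _⟩
    have h2 : (⋂ n, Prod.mk x ⁻¹' (D n \ ⋂ n, B n)) = ∅ := by
      ext z
      simp only [Set.mem_iInter, Set.mem_empty_iff_false, iff_false]
      intro h
      apply (h 0).2
      refine Set.mem_iInter.2 fun n => ?_
      have := (h n).1
      simp only [D, Set.mem_iInter, Set.mem_Iic] at this
      exact this n le_rfl
    rw [h2, measure_empty] at h1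
    obtain ⟨n, hn⟩ := (h1.eventually (gt_mem_nhds (ENNReal.half_pos hε))).exists
    exact ⟨n, le_of_lt hn⟩
  choose U hUo hU using fun n => (MeasurableSet.disjointed hEm n).residualEq_isOpen
  refine ⟨⋃ n, (U n ×ˢ Set.univ) ∩ ⋂ i ∈ Set.Iic n, H i, ?_, ?_⟩
  · refine isOpen_iUnion fun n => ((hUo n).prod isOpen_univ).inter ?_
    exact (Set.finite_Iic n).isOpen_biInter fun i _ => hHo i
  · have hU' : ∀ᶠ x in residual X, ∀ n, (x ∈ disjointed E n ↔ x ∈ U n) := by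
      refine eventually_countable_forall.2 fun n => ?_
      filter_upwards [hU n] with x hx
      exact iff_of_eq hx
    filter_upwards [hU', eventually_countable_forall.2 hH] with x hxU hxH
    obtain ⟨n, hn⟩ : ∃ n, x ∈ disjointed E n := by
      have : x ∈ ⋃ n, disjointed E n := by
        rw [iUnion_disjointed]; exact Set.mem_iUnion.2 (hEx x)
      exact Set.mem_iUnion.1 this
    have huniq : ∀ k, x ∈ U k → k = n := by
      intro k hk
      by_contra hne
      exact Set.disjoint_left.1 (disjoint_disjointed E hne) ((hxU k).2 hk) hn
    refine ⟨?_, ?_⟩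
    · intro z hz
      simp only [Set.mem_preimage, Set.mem_iInter] at hz
      simp only [Set.mem_preimage, Set.mem_iUnion]
      refine ⟨n, ⟨(hxU n).1 hn, trivial⟩, ?_⟩
      simp only [Set.mem_iInter]
      exact fun i _ => (hxH i).1 (hz i)
    · have hsub : Prod.mk x ⁻¹' (⋃ n, (U n ×ˢ Set.univ) ∩ ⋂ i ∈ Set.Iic n, H i) \
          Prod.mk x ⁻¹' (⋂ n, B n) ⊆ (⋃ i, (Prod.mk x ⁻¹' (H i) \ Prod.mk x ⁻¹' (B i))) ∪
          Prod.mk x ⁻¹' (D n \ ⋂ n, B n) := by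
        rintro z ⟨hz, hz'⟩
        simp only [Set.mem_preimage, Set.mem_iUnion] at hz
        obtain ⟨k, hk, hkH⟩ := hz
        obtain rfl := huniq k hk.1
        by_cases h : (x, z) ∈ D k
        · exact Or.inr ⟨h, hz'⟩
        · left
          simp only [D, Set.mem_iInter, not_forall] at h
          obtain ⟨i, hi, hiB⟩ := h
          simp only [Set.mem_iInter] at hkH
          exact Set.mem_iUnion.2 ⟨i, hkH i hi, hiB⟩
      calc _ ≤ _ := measure_mono hsub
        _ ≤ _ := measure_union_le _ _
        _ ≤ ε / 2 + ε / 2 := by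
          refine add_le_add ?_ (disjointed_subset E n hn)
          calc _ ≤ ∑' n, ν (Prod.mk x ⁻¹' (H n) \ Prod.mk x ⁻¹' (B n)) := measure_iUnion_le _
            _ ≤ ∑' n, δ n := ENNReal.tsum_le_tsum fun n => (hxH n).2
            _ ≤ ε / 2 := hδ.le
        _ = ε := ENNReal.add_halves ε

lemma OutApprox.of_measurable (ν : Measure X) [IsFiniteMeasure ν] {B : Set (X × X)}
    (hB : MeasurableSet B) : OutApprox ν B := by
  have key : ∀ B : Set (X × X), MeasurableSet B → OutApprox ν B ∧ OutApprox ν Bᶜ := by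
    refine MeasurableSet.induction_on_open ?_ ?_ ?_
    · intro U hU
      refine ⟨.of_isOpen ν hU, ?_⟩
      let _ := TopologicalSpace.upgradeIsCompletelyMetrizable X
      obtain ⟨f, hfo, hf⟩ := isGδ_iff_eq_iInter_nat.1 hU.isClosed_compl.isGδ
      rw [hf]
      exact .iInter ν (fun n => (hfo n).measurableSet) fun n => .of_isOpen ν (hfo n)
    · intro t _ h
      exact ⟨h.2, by rw [compl_compl]; exact h.1⟩
    · intro f _ hf h
      refine ⟨.iUnion ν fun n => (h n).1, ?_⟩
      rw [Set.compl_iUnion]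
      exact .iInter ν (fun n => (hf n).compl) fun n => (h n).2
  exact (key B hB).1

/-- meagre sets are avoided by countably many dense open sets -/
lemma exists_dense_open_of_residual {s : Set X} (hs : s ∈ residual X) :
    ∃ V : ℕ → Set X, (∀ n, IsOpen (V n)) ∧ (∀ n, Dense (V n)) ∧ (⋂ n, V n) ⊆ s := by
  obtain ⟨t, hts, htG, htd⟩ := mem_residual.1 hs
  obtain ⟨V, hVo, rfl⟩ := isGδ_iff_eq_iInter_nat.1 htG
  exact ⟨V, hVo, fun n => htd.mono (Set.iInter_subset _ _), hts⟩

lemma two_pow_null (ν : Measure X) (A : Set X) (h : ∀ j : ℕ, ν A ≤ (2⁻¹ : ℝ≥0∞) ^ j) :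
    ν A = 0 := by
  have h1 : Tendsto (fun j : ℕ => (2⁻¹ : ℝ≥0∞) ^ j) atTop (𝓝 0) :=
    ENNReal.tendsto_pow_atTop_nhds_zero_of_lt_one (by simp)
  exact le_antisymm (ge_of_tendsto' h1 h) (zero_le)

theorem part2 (ν : Measure X) [IsFiniteMeasure ν] :
    ∃ U : Set ((ℕ → ℕ) × (X × X)), SigmaClass 3 U ∧
      (∀ x : ℕ → ℕ, {p : X × X | (x, p) ∈ U} ∈
        FubiniProd {A : Set X | IsMeagre A} {A : Set X | ν A = 0}) ∧
      ∀ A ∈ FubiniProd {A : Set X | IsMeagre A} {A : Set X | ν A = 0},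
        ∃ x : ℕ → ℕ, A ⊆ {p : X × X | (x, p) ∈ U} := by
  classical
  obtain ⟨O, hO, e, he⟩ := exists_base X
  obtain ⟨O2, hO2, he2⟩ := exists_base (X × X)
  have hOo : ∀ n, IsOpen (O n) := fun n => hO.isOpen ⟨n, rfl⟩
  have hO2o : ∀ n, IsOpen (O2 n) := fun n => hO2.isOpen ⟨n, rfl⟩
  let P : ℕ → Set (X × X) → Prop := fun j R =>
    ∀ᶠ x in residual X, ν (Prod.mk x ⁻¹' R) ≤ (2⁻¹ : ℝ≥0∞) ^ j
  let T : ℕ → ℕ → Set (X × X) := fun m n =>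
    if (O m).Nonempty → (O n ∩ O m).Nonempty then O n ×ˢ Set.univ else Set.univ
  have hT : ∀ m n, IsOpen (T m n) := by
    intro m n
    dsimp only [T]
    split_ifs
    · exact (hOo n).prod isOpen_univ
    · exact isOpen_univ
  refine ⟨UU id P O2 T, sigmaClass_UU id continuous_id P O2 hO2o T hT, ?_, ?_⟩
  · intro c
    refine ⟨_, measurable_UU id continuous_id P O2 hO2o T hT c, subset_rfl, ?_⟩
    -- for comeagre many x the section is null
    have h1 : ∀ᶠ x in residual X, ∀ j i,
        ν (Prod.mk x ⁻¹' (Ss (P j) O2 (pg c j) i)) ≤ (2⁻¹ : ℝ≥0∞) ^ j := by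
      refine eventually_countable_forall.2 fun j => eventually_countable_forall.2 fun i => ?_
      by_cases h : P j (Rr O2 (pg c j) i)
      · filter_upwards [h] with x hx
        exact (measure_mono (fun z hz => hz.2)).trans hx
      · refine Eventually.of_forall fun x => ?_
        have : Prod.mk x ⁻¹' (Ss (P j) O2 (pg c j) i) = ∅ := by
          ext z; simp [Ss, h]
        simp [this]
    have h2 : ∀ᶠ x in residual X, ∀ k, ∃ m, ∀ z : X, (x, z) ∈ T m (pf c k m) := by
      refine eventually_countable_forall.2 fun k => ?_
      let V : Set X := ⋃ m, {x | ∀ z : X, (x, z) ∈ T m (pf c k m)}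
      have hVm : ∀ m, {x | ∀ z : X, (x, z) ∈ T m (pf c k m)} =
          if (O m).Nonempty → (O (pf c k m) ∩ O m).Nonempty then O (pf c k m) else Set.univ := by
        intro m
        ext x
        dsimp only [T]
        split_ifs
        · simp only [Set.mem_ofPred_eq, Set.mem_prod, Set.mem_univ, and_true]
          exact ⟨fun h => h x, fun h _ => h⟩
        · simp
      have hVo : IsOpen V := by
        refine isOpen_iUnion fun m => ?_
        rw [hVm]
        split_ifs
        · exact hOo _
        · exact isOpen_univ
      have hVd : Dense V := by
        rw [hO.dense_iff]
        rintro _ ⟨m, rfl⟩ hne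
        by_cases h : (O m).Nonempty → (O (pf c k m) ∩ O m).Nonempty
        · obtain ⟨x, hx1, hx2⟩ := h hne
          refine ⟨x, hx2, Set.mem_iUnion.2 ⟨m, ?_⟩⟩
          rw [hVm, if_pos h]; exact hx1
        · obtain ⟨x, hx⟩ := hne
          refine ⟨x, hx, Set.mem_iUnion.2 ⟨m, ?_⟩⟩
          rw [hVm, if_neg h]; trivial
      filter_upwards [residual_of_dense_open hVo hVd] with x hx
      exact Set.mem_iUnion.1 hx
    change _ ∈ residual X
    filter_upwards [h1, h2] with x hx1 hx2
    simp only [Set.mem_compl_iff, Set.mem_ofPred_eq, not_not]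
    refine two_pow_null ν _ fun j => ?_
    calc _ ≤ ν (⋃ i, Prod.mk x ⁻¹' (Ss (P j) O2 (pg c j) i)) := by
          apply measure_mono
          rintro z (hz | ⟨k, hz⟩)
          · obtain ⟨i, hi⟩ := hz j
            exact Set.mem_iUnion.2 ⟨i, hi⟩
          · obtain ⟨m, hm⟩ := hx2 k
            exact absurd (hm z) (hz m)
      _ = ⨆ i, ν (Prod.mk x ⁻¹' (Ss (P j) O2 (pg c j) i)) := by
          apply Directed.measure_iUnion
          intro i i'
          obtain ⟨k, hk1, hk2⟩ := Ss_directed (P j) O2 (pg c j) i i'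
          exact ⟨k, Set.preimage_mono hk1, Set.preimage_mono hk2⟩
      _ ≤ _ := iSup_le fun i => hx1 j i
  · rintro A ⟨B, hB, hAB, hBM⟩
    have hBM' : ∀ᶠ x in residual X, ν (Prod.mk x ⁻¹' B) = 0 := by
      have : _ ∈ residual X := hBM
      filter_upwards [this] with x hx
      simp only [Set.mem_compl_iff, Set.mem_ofPred_eq, not_not] at hx
      exact hx
    choose H hHo hH using fun j : ℕ => OutApprox.of_measurable ν hB ((2⁻¹ : ℝ≥0∞) ^ j) (by simp)
    have hPH : ∀ j, P j (H j) := by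
      intro j
      filter_upwards [hBM', hH j] with x hx1 hx2
      calc ν (Prod.mk x ⁻¹' (H j))
          ≤ ν ((Prod.mk x ⁻¹' (H j) \ Prod.mk x ⁻¹' B) ∪ Prod.mk x ⁻¹' B) :=
            measure_mono (by rw [Set.sdiff_union_self]; exact Set.subset_union_left)
        _ ≤ _ := measure_union_le _ _
        _ ≤ _ := by rw [hx1, add_zero]; exact hx2.2
    have hPmono : ∀ j A B, A ⊆ B → P j B → P j A := by
      intro j A B hAB h
      filter_upwards [h] with x hx
      exact (measure_mono (Set.preimage_mono hAB)).trans hx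
    choose g hg using fun j => exists_seq_open O2 hO2 he2 (P j) (hPmono j) (H j) (hHo j) (hPH j)
    obtain ⟨V, hVo, hVd, hV⟩ := exists_dense_open_of_residual (eventually_countable_forall.2 hH)
    have hf : ∀ k m, ∃ n, T m n ⊆ V k ×ˢ Set.univ := by
      intro k m
      by_cases hm : (O m).Nonempty
      · obtain ⟨x, hx1, hx2⟩ := (hVd k).inter_open_nonempty _ (hOo m) hm
        obtain ⟨_, ⟨n, rfl⟩, hxn, hn⟩ := hO.exists_subset_of_mem_open hx2 (hVo k)
        refine ⟨n, ?_⟩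
        dsimp only [T]
        rw [if_pos fun _ => ⟨x, hxn, hx1⟩]
        exact Set.prod_mono hn subset_rfl
      · refine ⟨e, ?_⟩
        dsimp only [T]
        rw [if_pos fun h => absurd h hm, he]
        simp
    choose f hf using hf
    obtain ⟨c, hcg, hcf⟩ := exists_code g f
    refine ⟨c, fun p hp => ?_⟩
    change (_ ∨ _)
    rw [hcg, hcf]
    by_cases hpV : p.1 ∈ ⋂ n, V n
    · left
      intro j
      exact hg j p ((hV hpV j).1 (hAB hp))
    · right
      simp only [Set.mem_iInter, not_forall] at hpV
      obtain ⟨k, hk⟩ := hpV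
      exact ⟨k, fun m hm => hk (hf k m hm).1⟩

end CatNull

section NullCat

open Filter Topology
open scoped ENNReal

set_option linter.unusedSectionVars false

variable {X : Type} [TopologicalSpace X] [PolishSpace X] [MeasurableSpace X] [BorelSpace X]

/-- the section at `x` of `⋃ n, E n ×ˢ O n` -/
def Sec (O E : ℕ → Set X) (x : X) : Set X := {z | ∃ n, x ∈ E n ∧ z ∈ O n}

lemma isOpen_Sec (O E : ℕ → Set X) (hO : ∀ n, IsOpen (O n)) (x : X) : IsOpen (Sec O E x) := by
  have : Sec O E x = ⋃ n, ⋃ (_ : x ∈ E n), O n := by ext z; simp [Sec]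
  rw [this]
  exact isOpen_iUnion fun a => isOpen_iUnion fun _ => hO _

/-- uniform Baire property of all the sections of a Borel set -/
def UBaire (O : ℕ → Set X) (B : Set (X × X)) : Prop :=
  ∃ (E : ℕ → Set X) (D : ℕ → ℕ → Set X), (∀ n, MeasurableSet (E n)) ∧
    (∀ k n, MeasurableSet (D k n)) ∧ (∀ k x, Dense (Sec O (D k) x)) ∧
    ∀ x z, (∀ k, z ∈ Sec O (D k) x) → ((x, z) ∈ B ↔ z ∈ Sec O E x)

lemma UBaire.of_isOpen (O : ℕ → Set X)
    (hO : TopologicalSpace.IsTopologicalBasis (Set.range O)) {B : Set (X × X)} (hB : IsOpen B) :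
    UBaire O B := by
  have hOo : ∀ n, IsOpen (O n) := fun n => hO.isOpen ⟨n, rfl⟩
  refine ⟨fun n => ⋃ m, ⋃ (_ : O m ×ˢ O n ⊆ B), O m, fun _ _ => Set.univ, ?_, ?_, ?_, ?_⟩
  · intro n
    exact (isOpen_iUnion fun m => isOpen_iUnion fun _ => hOo m).measurableSet
  · simp
  · intro k x
    have : Sec O (fun _ => Set.univ) x = Set.univ := by
      refine Set.eq_univ_of_forall fun z => ?_
      obtain ⟨_, ⟨n, rfl⟩, hzn, -⟩ := hO.exists_subset_of_mem_open (Set.mem_univ z) isOpen_univ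
      exact ⟨n, trivial, hzn⟩
    rw [this]; exact dense_univ
  · intro x z _
    constructor
    · intro h
      obtain ⟨u, v, hu, hv, hxu, hzv, huv⟩ := isOpen_prod_iff.1 hB x z h
      obtain ⟨_, ⟨m, rfl⟩, hxm, hm⟩ := hO.exists_subset_of_mem_open hxu hu
      obtain ⟨_, ⟨n, rfl⟩, hzn, hn⟩ := hO.exists_subset_of_mem_open hzv hv
      refine ⟨n, ?_, hzn⟩
      exact Set.mem_iUnion.2 ⟨m, Set.mem_iUnion.2 ⟨(Set.prod_mono hm hn).trans huv, hxm⟩⟩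
    · rintro ⟨n, hx, hz⟩
      obtain ⟨m, hx⟩ := Set.mem_iUnion.1 hx
      obtain ⟨h, hx⟩ := Set.mem_iUnion.1 hx
      exact h ⟨hx, hz⟩

lemma UBaire.compl (O : ℕ → Set X)
    (hO : TopologicalSpace.IsTopologicalBasis (Set.range O)) {B : Set (X × X)} (hB : UBaire O B) :
    UBaire O Bᶜ := by
  have hOo : ∀ n, IsOpen (O n) := fun n => hO.isOpen ⟨n, rfl⟩
  obtain ⟨E, D, hE, hD, hDd, h⟩ := hB
  let E' : ℕ → Set X := fun n => ⋂ m, ⋂ (_ : (O m ∩ O n).Nonempty), (E m)ᶜ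
  have hE' : ∀ n, MeasurableSet (E' n) := fun n =>
    MeasurableSet.iInter fun m => MeasurableSet.iInter fun _ => (hE m).compl
  refine ⟨E', fun k => Nat.casesOn k (fun n => E n ∪ E' n) D, hE', ?_, ?_, ?_⟩
  · intro k n
    cases k with
    | zero => exact (hE n).union (hE' n)
    | succ k => exact hD k n
  · intro k x
    cases k with
    | zero =>
      rw [hO.dense_iff]
      rintro _ ⟨n, rfl⟩ hne
      by_cases hx : x ∈ E' n
      · obtain ⟨z, hz⟩ := hne
        exact ⟨z, hz, n, Or.inr hx, hz⟩
      · simp only [E', Set.mem_iInter, not_forall, Set.mem_compl_iff, not_not] at hx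
        obtain ⟨m, ⟨z, hz1, hz2⟩, hm⟩ := hx
        exact ⟨z, hz2, m, Or.inl hm, hz1⟩
    | succ k => exact hDd k x
  · intro x z hz
    have h1 := h x z fun k => hz (k + 1)
    rw [Set.mem_compl_iff, h1]
    constructor
    · intro hn
      obtain ⟨n, hx | hx, hzn⟩ := hz 0
      · exact absurd ⟨n, hx, hzn⟩ hn
      · exact ⟨n, hx, hzn⟩
    · rintro ⟨n, hx, hzn⟩ ⟨m, hxm, hzm⟩
      simp only [E', Set.mem_iInter, Set.mem_compl_iff] at hx
      exact hx m ⟨z, hzm, hzn⟩ hxm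

lemma UBaire.iUnion (O : ℕ → Set X) {B : ℕ → Set (X × X)} (hB : ∀ i, UBaire O (B i)) :
    UBaire O (⋃ i, B i) := by
  choose E D hE hD hDd h using hB
  refine ⟨fun n => ⋃ i, E i n, fun k => D k.unpair.1 k.unpair.2,
    fun n => MeasurableSet.iUnion fun i => hE i n, fun k n => hD _ _ _, fun k x => hDd _ _ _, ?_⟩
  intro x z hz
  have h1 : ∀ i, (x, z) ∈ B i ↔ z ∈ Sec O (E i) x := by
    intro i
    refine h i x z fun k => ?_
    have := hz (Nat.pair i k)
    simpa using this
  rw [Set.mem_iUnion]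
  constructor
  · rintro ⟨i, hi⟩
    obtain ⟨n, hn, hzn⟩ := (h1 i).1 hi
    exact ⟨n, Set.mem_iUnion.2 ⟨i, hn⟩, hzn⟩
  · rintro ⟨n, hn, hzn⟩
    obtain ⟨i, hi⟩ := Set.mem_iUnion.1 hn
    exact ⟨i, (h1 i).2 ⟨n, hi, hzn⟩⟩

lemma UBaire.of_measurable (O : ℕ → Set X)
    (hO : TopologicalSpace.IsTopologicalBasis (Set.range O)) {B : Set (X × X)}
    (hB : MeasurableSet B) : UBaire O B := by
  have key : ∀ B : Set (X × X), MeasurableSet B → UBaire O B := by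
    refine MeasurableSet.induction_on_open ?_ ?_ ?_
    · intro U hU
      exact .of_isOpen O hO hU
    · intro t _ h
      exact .compl O hO h
    · intro f _ _ h
      exact .iUnion O h
  exact key B hB

/-- The covering fact for `N ⊗ M`. -/
lemma cover_null_meagre (ν : Measure X) [IsFiniteMeasure ν] {B : Set (X × X)}
    (hB : MeasurableSet B) (hBM : ∀ᵐ x ∂ν, IsMeagre (Prod.mk x ⁻¹' B)) :
    ∃ V : ℕ → Set (X × X), (∀ k, IsOpen (V k)) ∧ (∀ k x, Dense (Prod.mk x ⁻¹' (V k))) ∧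
      ∀ᵐ x ∂ν, ∀ z, (x, z) ∈ B → ∃ k, (x, z) ∉ V k := by
  obtain ⟨O, hO, -⟩ := exists_base X
  have hOo : ∀ n, IsOpen (O n) := fun n => hO.isOpen ⟨n, rfl⟩
  obtain ⟨E, D, hE, hD, hDd, h⟩ := UBaire.of_measurable O hO hB
  have h1 : ∀ᵐ x ∂ν, ∀ z, (x, z) ∈ B → ∃ k, z ∉ Sec O (D k) x := by
    filter_upwards [hBM] with x hx z hz
    by_contra! hcon
    have hz' := (h x z hcon).1 hz
    refine not_isMeagre_of_isOpen (isOpen_Sec O E hOo x) ⟨z, hz'⟩ ?_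
    have hD' : ∀ᶠ w in residual X, ∀ k, w ∈ Sec O (D k) x :=
      eventually_countable_forall.2 fun k =>
        residual_of_dense_open (isOpen_Sec O _ hOo x) (hDd k x)
    have hx' : ∀ᶠ w in residual X, w ∉ Prod.mk x ⁻¹' B := hx
    change _ ∈ residual X
    filter_upwards [hD', hx'] with w hw1 hw2 hw3
    exact hw2 ((h x w hw1).2 hw3)
  have hpos : ∀ j : ℕ, (2⁻¹ : ℝ≥0∞) ^ j ≠ 0 := by simp
  choose δ δpos hδ using fun j : ℕ => ENNReal.exists_pos_sum_of_countable' (hpos j) ℕ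
  choose G hDG hGo _ hG using fun k j n : ℕ =>
    (hD k n).exists_isOpen_sdiff_lt (measure_ne_top ν _) (δpos j n).ne'
  have h2 : ∀ᵐ x ∂ν, ∀ k, ∃ j, ∀ n, x ∈ G k j n → x ∈ D k n := by
    refine ae_all_iff.2 fun k => ?_
    rw [ae_iff]
    refine two_pow_null ν _ fun j => ?_
    calc _ ≤ ν (⋃ n, G k j n \ D k n) := by
          apply measure_mono
          intro x hx
          simp only [Set.mem_ofPred_eq, not_exists, not_forall] at hx
          obtain ⟨n, hn1, hn2⟩ := hx j
          exact Set.mem_iUnion.2 ⟨n, hn1, hn2⟩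
      _ ≤ ∑' n, ν (G k j n \ D k n) := measure_iUnion_le _
      _ ≤ ∑' n, δ j n := ENNReal.tsum_le_tsum fun n => (hG k j n).le
      _ ≤ _ := (hδ j).le
  refine ⟨fun q => ⋃ n, G q.unpair.1 q.unpair.2 n ×ˢ O n, ?_, ?_, ?_⟩
  · intro q
    exact isOpen_iUnion fun n => (hGo _ _ _).prod (hOo n)
  · intro q x
    refine (hDd q.unpair.1 x).mono ?_
    rintro z ⟨n, hx, hz⟩
    exact Set.mem_iUnion.2 ⟨n, hDG _ _ _ hx, hz⟩
  · filter_upwards [h1, h2] with x hx1 hx2 z hz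
    obtain ⟨k, hk⟩ := hx1 z hz
    obtain ⟨j, hj⟩ := hx2 k
    refine ⟨Nat.pair k j, fun hmem => hk ?_⟩
    obtain ⟨n, hn⟩ := Set.mem_iUnion.1 hmem
    simp only [Nat.unpair_pair] at hn
    exact ⟨n, hj n hn.1, hn.2⟩

/-- finite unions of basic sets -/
def FinCov (O : ℕ → Set (X × X)) (n : ℕ) : Set (X × X) :=
  ⋃ i ∈ Denumerable.ofNat (Finset ℕ) n, O i

lemma exists_FinCov (O : ℕ → Set (X × X)) (s : Finset ℕ) : ∃ n, FinCov O n = ⋃ i ∈ s, O i := by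
  obtain ⟨n, hn⟩ := (Denumerable.eqv (Finset ℕ)).symm.surjective s
  refine ⟨n, ?_⟩
  have : Denumerable.ofNat (Finset ℕ) n = s := hn
  rw [FinCov, this]

lemma isOpen_FinCov (O : ℕ → Set (X × X)) (hO : ∀ n, IsOpen (O n)) (n : ℕ) : IsOpen (FinCov O n) :=
  isOpen_biUnion fun i _ => hO i

lemma isOpen_hit (W : Set (X × X)) (hW : IsOpen W) (V : Set X) (hV : IsOpen V) :
    IsOpen {x | ∃ z ∈ V, (x, z) ∈ W} := by
  have : {x | ∃ z ∈ V, (x, z) ∈ W} = Prod.fst '' (W ∩ (Set.univ ×ˢ V)) := by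
    ext x
    simp only [Set.mem_ofPred_eq, Set.mem_image, Set.mem_inter_iff, Set.mem_prod, Set.mem_univ,
      true_and, Prod.exists, exists_and_right, exists_eq_right]
    exact ⟨fun ⟨z, h1, h2⟩ => ⟨z, h2, h1⟩, fun ⟨z, h1, h2⟩ => ⟨z, h2, h1⟩⟩
  rw [this]
  exact isOpenMap_fst _ (hW.inter (isOpen_univ.prod hV))

lemma exists_finite_hit (ν : Measure X) [IsFiniteMeasure ν] (O2 : ℕ → Set (X × X))
    (hO2 : TopologicalSpace.IsTopologicalBasis (Set.range O2)) (V : Set (X × X)) (hV : IsOpen V)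
    (hVd : ∀ x, Dense (Prod.mk x ⁻¹' V)) (Q : Set X) (hQ : IsOpen Q) (hQn : Q.Nonempty)
    (ε : ℝ≥0∞) (hε : ε ≠ 0) :
    ∃ n, FinCov O2 n ⊆ V ∧ ν {x | ∃ z ∈ Q, (x, z) ∈ FinCov O2 n}ᶜ ≤ ε := by
  classical
  have hO2o : ∀ n, IsOpen (O2 n) := fun n => hO2.isOpen ⟨n, rfl⟩
  let s : ℕ → Finset ℕ := fun N => (Finset.range N).filter fun i => O2 i ⊆ V
  choose c hc using fun N => exists_FinCov O2 (s N)
  let A : ℕ → Set X := fun N => {x | ∃ z ∈ Q, (x, z) ∈ FinCov O2 (c N)}ᶜ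
  have h1 : Tendsto (ν ∘ A) atTop (𝓝 (ν (⋂ N, A N))) := by
    apply tendsto_measure_iInter_atTop
    · intro N
      exact (isOpen_hit _ (isOpen_FinCov O2 hO2o _) Q hQ).measurableSet.compl.nullMeasurableSet
    · intro a b hab
      refine Set.compl_subset_compl.2 ?_
      rintro x ⟨z, hz, hxz⟩
      refine ⟨z, hz, ?_⟩
      rw [hc] at hxz ⊢
      simp only [s, Set.mem_iUnion, Finset.mem_filter, Finset.mem_range, exists_prop] at hxz ⊢
      obtain ⟨i, ⟨hi, hiV⟩, hm⟩ := hxz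
      exact ⟨i, ⟨hi.trans_le hab, hiV⟩, hm⟩
    · exact ⟨0, measure_ne_top _ _⟩
  have h2 : (⋂ N, A N) = ∅ := by
    refine Set.eq_empty_of_forall_notMem fun x hx => ?_
    obtain ⟨z, hzQ, hzV⟩ := (hVd x).inter_open_nonempty Q hQ hQn
    obtain ⟨_, ⟨n, rfl⟩, hn, hnV⟩ := hO2.exists_subset_of_mem_open hzV hV
    refine Set.mem_iInter.1 hx (n + 1) ⟨z, hzQ, ?_⟩
    rw [hc]
    simp only [s, Set.mem_iUnion, Finset.mem_filter, Finset.mem_range, exists_prop]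
    exact ⟨n, ⟨Nat.lt_succ_self n, hnV⟩, hn⟩
  rw [h2, measure_empty] at h1
  obtain ⟨N, hN⟩ := (h1.eventually (gt_mem_nhds (pos_iff_ne_zero.2 hε))).exists
  refine ⟨c N, ?_, le_of_lt hN⟩
  rw [hc]
  refine Set.iUnion₂_subset fun i hi => ?_
  exact (Finset.mem_filter.1 hi).2

theorem part1 (ν : Measure X) [IsFiniteMeasure ν] :
    ∃ U : Set ((ℕ → ℕ) × (X × X)), SigmaClass 3 U ∧
      (∀ x : ℕ → ℕ, {p : X × X | (x, p) ∈ U} ∈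
        FubiniProd {A : Set X | ν A = 0} {A : Set X | IsMeagre A}) ∧
      ∀ A ∈ FubiniProd {A : Set X | ν A = 0} {A : Set X | IsMeagre A},
        ∃ x : ℕ → ℕ, A ⊆ {p : X × X | (x, p) ∈ U} := by
  classical
  obtain ⟨O, hO, he⟩ := exists_base X
  obtain ⟨O2, hO2, -⟩ := exists_base (X × X)
  have hOo : ∀ n, IsOpen (O n) := fun n => hO.isOpen ⟨n, rfl⟩
  have hO2o : ∀ n, IsOpen (O2 n) := fun n => hO2.isOpen ⟨n, rfl⟩
  let P : ℕ → Set X → Prop := fun j R => ν R ≤ (2⁻¹ : ℝ≥0∞) ^ j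
  let C : ℕ → ℕ → Prop := fun m n => (O m.unpair.1).Nonempty →
    ν {x | ∃ z ∈ O m.unpair.1, (x, z) ∈ FinCov O2 n}ᶜ ≤ (2⁻¹ : ℝ≥0∞) ^ m.unpair.2
  let T : ℕ → ℕ → Set (X × X) := fun m n => if C m n then FinCov O2 n else Set.univ
  have hT : ∀ m n, IsOpen (T m n) := by
    intro m n
    dsimp only [T]
    split_ifs
    · exact isOpen_FinCov O2 hO2o n
    · exact isOpen_univ
  have hTm : ∀ m n, (O m.unpair.1).Nonempty →
      ν {x | ∃ z ∈ O m.unpair.1, (x, z) ∈ T m n}ᶜ ≤ (2⁻¹ : ℝ≥0∞) ^ m.unpair.2 := by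
    intro m n hne
    by_cases h : C m n
    · have : T m n = FinCov O2 n := if_pos h
      rw [this]; exact h hne
    · have : T m n = Set.univ := if_neg h
      obtain ⟨z, hz⟩ := hne
      have h0 : {x : X | ∃ z ∈ O m.unpair.1, (x, z) ∈ T m n}ᶜ = ∅ := by
        rw [Set.compl_empty_iff]
        exact Set.eq_univ_of_forall fun x => ⟨z, hz, by rw [this]; trivial⟩
      rw [h0]; simp
  refine ⟨UU Prod.fst P O T, sigmaClass_UU _ continuous_fst P O hOo T hT, ?_, ?_⟩
  · intro c
    refine ⟨_, measurable_UU _ continuous_fst P O hOo T hT c, subset_rfl, ?_⟩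
    have h1 : ∀ᵐ x ∂ν, ¬ ∀ j, ∃ i, x ∈ Ss (P j) O (pg c j) i := by
      rw [ae_iff]
      refine two_pow_null ν _ fun j => ?_
      calc _ ≤ ν (⋃ i, Ss (P j) O (pg c j) i) := by
            apply measure_mono
            intro x hx
            simp only [Set.mem_ofPred_eq, not_not] at hx
            exact Set.mem_iUnion.2 (hx j)
        _ = ⨆ i, ν (Ss (P j) O (pg c j) i) :=
            Directed.measure_iUnion (Ss_directed (P j) O (pg c j))
        _ ≤ _ := by
            refine iSup_le fun i => ?_
            by_cases h : P j (Rr O (pg c j) i)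
            · exact (measure_mono (fun z hz => hz.2)).trans h
            · have : Ss (P j) O (pg c j) i = ∅ := by
                ext z; simp [Ss, h]
              simp [this]
    have h2 : ∀ᵐ x ∂ν, ∀ k a, (O a).Nonempty → ∃ j, ∃ z ∈ O a,
        (x, z) ∈ T (Nat.pair a j) (pf c k (Nat.pair a j)) := by
      refine ae_all_iff.2 fun k => ae_all_iff.2 fun a => ?_
      by_cases hne : (O a).Nonempty
      · rw [ae_iff]
        refine two_pow_null ν _ fun j => ?_
        have := hTm (Nat.pair a j) (pf c k (Nat.pair a j)) (by simpa using hne)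
        simp only [Nat.unpair_pair] at this
        refine (measure_mono ?_).trans this
        intro x hx hx'
        exact hx fun _ => ⟨j, hx'⟩
      · exact Eventually.of_forall fun x h => absurd h hne
    have h3 : ∀ᵐ x ∂ν, IsMeagre {z | (x, z) ∈ {y | (c, y) ∈ UU Prod.fst P O T}} := by
      filter_upwards [h1, h2] with x hx1 hx2
      have h4 : ∀ᶠ z in residual X, ∀ k, ∃ m, (x, z) ∈ T m (pf c k m) := by
        refine eventually_countable_forall.2 fun k => ?_
        have ho : IsOpen (⋃ m, Prod.mk x ⁻¹' (T m (pf c k m))) :=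
          isOpen_iUnion fun m => (hT _ _).preimage (Continuous.prodMk_right x)
        have hd : Dense (⋃ m, Prod.mk x ⁻¹' (T m (pf c k m))) := by
          rw [hO.dense_iff]
          rintro _ ⟨a, rfl⟩ hne
          obtain ⟨j, z, hz, hzT⟩ := hx2 k a hne
          exact ⟨z, hz, Set.mem_iUnion.2 ⟨_, hzT⟩⟩
        filter_upwards [residual_of_dense_open ho hd] with z hz
        rw [Set.mem_iUnion] at hz
        obtain ⟨m, hm⟩ := hz
        exact ⟨m, hm⟩
      change _ ∈ residual X
      filter_upwards [h4] with z hz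
      rintro (h | ⟨k, h⟩)
      · exact hx1 h
      · obtain ⟨m, hm⟩ := hz k
        exact h m hm
    exact h3
  · rintro A ⟨B, hB, hAB, hBM⟩
    have hBM' : ∀ᵐ x ∂ν, IsMeagre (Prod.mk x ⁻¹' B) := hBM
    obtain ⟨V, hVo, hVd, hV⟩ := cover_null_meagre ν hB hBM'
    have hH : ∀ j : ℕ, ∃ H, H ⊇ {x | ¬ ∀ z, (x, z) ∈ B → ∃ k, (x, z) ∉ V k} ∧ IsOpen H ∧
        ν H < (2⁻¹ : ℝ≥0∞) ^ j := by
      intro j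
      refine Set.exists_isOpen_lt_of_lt _ _ ?_
      rw [ae_iff.1 hV]
      exact pos_iff_ne_zero.2 (by simp)
    choose H hHs hHo hH using hH
    choose g hg using fun j => exists_seq_open O hO he (P j)
      (fun A B hAB h => (measure_mono hAB).trans h) (H j) (hHo j) (hH j).le
    have hf : ∀ k m, ∃ n, T m n ⊆ V k := by
      intro k m
      by_cases hm : (O m.unpair.1).Nonempty
      · obtain ⟨n, hn1, hn2⟩ := exists_finite_hit ν O2 hO2 (V k) (hVo k) (hVd k) _
          (hOo m.unpair.1) hm ((2⁻¹ : ℝ≥0∞) ^ m.unpair.2) (by simp)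
        refine ⟨n, ?_⟩
        have : T m n = FinCov O2 n := if_pos fun _ => hn2
        rw [this]; exact hn1
      · obtain ⟨n, hn⟩ := exists_FinCov O2 ∅
        refine ⟨n, ?_⟩
        have : T m n = FinCov O2 n := if_pos fun h => absurd h hm
        rw [this, hn]
        simp
    choose f hf using hf
    obtain ⟨c, hcg, hcf⟩ := exists_code g f
    refine ⟨c, fun p hp => ?_⟩
    change (_ ∨ _)
    rw [hcg, hcf]
    by_cases hp1 : ∀ z, (p.1, z) ∈ B → ∃ k, (p.1, z) ∉ V k
    · right
      obtain ⟨k, hk⟩ := hp1 p.2 (hAB hp)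
      exact ⟨k, fun m hm => hk (hf k m hm)⟩
    · left
      intro j
      exact hg j p.1 (hHs j hp1)

end NullCat

/-- There are `Σ^0_3` universal sets for the Fubini products `N ⊗ M` and
`M ⊗ N` on the square of a Polish space `X` with a σ-finite Borel measure `μ`:
sets whose sections all lie in the product ideal and such that every member of
the product ideal is contained in some section. -/
theorem exists_sigma3_universal_fubini_products
    (X : Type) [TopologicalSpace X] [PolishSpace X] [MeasurableSpace X] [BorelSpace X]
    (μ : Measure X) [SigmaFinite μ] :
    (∃ U : Set ((ℕ → ℕ) × (X × X)), SigmaClass 3 U ∧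
      (∀ x : ℕ → ℕ, {p : X × X | (x, p) ∈ U} ∈
        FubiniProd {A : Set X | μ A = 0} {A : Set X | IsMeagre A}) ∧
      ∀ A ∈ FubiniProd {A : Set X | μ A = 0} {A : Set X | IsMeagre A},
        ∃ x : ℕ → ℕ, A ⊆ {p : X × X | (x, p) ∈ U}) ∧
    (∃ U : Set ((ℕ → ℕ) × (X × X)), SigmaClass 3 U ∧
      (∀ x : ℕ → ℕ, {p : X × X | (x, p) ∈ U} ∈
        FubiniProd {A : Set X | IsMeagre A} {A : Set X | μ A = 0}) ∧
      ∀ A ∈ FubiniProd {A : Set X | IsMeagre A} {A : Set X | μ A = 0},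
        ∃ x : ℕ → ℕ, A ⊆ {p : X × X | (x, p) ∈ U}) := by
  have h : ∀ A : Set X, μ.toFinite A = 0 ↔ μ A = 0 := fun A => toFinite_apply_eq_zero_iff
  have h1 := part1 μ.toFinite
  have h2 := part2 μ.toFinite
  simp only [h] at h1 h2
  exact ⟨h1, h2⟩
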